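/- Let 0 < δ ≤ δ̄, let C : [0,1] → Matrix (Fin D) (Fin D) ℝ be continuous with δ|y|² ≤ yᵀC(t)C(t)ᵀy ≤ δ̄|y|² for all y ∈ ℝ^D, t ∈ [0,1], Σ(t,s) := ∫_t^s C(u)C(u)ᵀ du, and Γ(t,s,y) := exp(−(1/2) yᵀΣ(t,s)⁻¹y)/((2π)^{D/2}(det Σ(t,s))^{1/2}). Let α ∈ (0,1), T ∈ (0,1], let g : ℝ^D → ℝ be C² with bounded first and second derivatives and with all second partial derivatives α-Hölder (finite seminorms [∂_{y_e}∂_{y_d}g]_α), and let f : [0,T]×ℝ^D → ℝ be bounded continuous with finite parabolic α-Hölder seminorm [f]_α. Define u(t,y) := ∫_{ℝ^D} Γ(t,T,x−y)g(x)dx + ∫_t^T∫_{ℝ^D} Γ(t,s,x−y)f(s,x)dxds. Then there is a constant c > 0 depending only on δ, δ̄, D, α such that for every d ∈ {1,…,D} and all (t,y) ∈ [0,T)×ℝ^D: | ∂_{y_d}u(t,y) − ∂_{y_d}g(y) | ≤ c ( Σ_{d',e}[∂_{y_{d'}}∂_{y_e}g]_α + [f]_α ) (T−t)^{(1+α)/2}.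 -/

import Mathlib

noncomputable section

open Real Set Matrix

/-- `Sig C t s = ∫_t^s C(u) C(u)ᵀ du` (entrywise Bochner integral). -/
noncomputable def Sig {D : ℕ} (C : ℝ → Matrix (Fin D) (Fin D) ℝ) (t s : ℝ) :
    Matrix (Fin D) (Fin D) ℝ :=
  fun i j => ∫ u in t..s, (C u * (C u)ᵀ) i j

/-- Uniform ellipticity: `δ |y|² ≤ yᵀ C(t)C(t)ᵀ y ≤ δ' |y|²` for all `t ∈ [0,1]`. -/
def Ellip (D : ℕ) (δ δ' : ℝ) (C : ℝ → Matrix (Fin D) (Fin D) ℝ) : Prop :=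
  ∀ t ∈ Set.Icc (0:ℝ) 1, ∀ y : Fin D → ℝ,
    δ * (∑ i, y i ^ 2) ≤ (∑ i, ∑ j, y i * (C t * (C t)ᵀ) i j * y j) ∧
    (∑ i, ∑ j, y i * (C t * (C t)ᵀ) i j * y j) ≤ δ' * (∑ i, y i ^ 2)

/-- Euclidean norm on `ℝ^D`. -/
noncomputable def en {D : ℕ} (x : Fin D → ℝ) : ℝ := Real.sqrt (∑ i, x i ^ 2)

/-- The Gaussian kernel `Γ(t,s,y)`. -/
noncomputable def Gam {D : ℕ} (C : ℝ → Matrix (Fin D) (Fin D) ℝ) (t s : ℝ)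
    (y : Fin D → ℝ) : ℝ :=
  Real.exp (-(1/2) * ∑ i, ∑ j, y i * (Sig C t s)⁻¹ i j * y j) /
    ((2 * Real.pi) ^ ((D : ℝ) / 2) * Real.sqrt (Sig C t s).det)

/-- First partial derivative in the `d`-th coordinate direction. -/
noncomputable def pd {D : ℕ} (g : (Fin D → ℝ) → ℝ) (d : Fin D) (x : Fin D → ℝ) : ℝ :=
  fderiv ℝ g x (Pi.single d 1)

/-- Second partial derivative. -/
noncomputable def pdd {D : ℕ} (g : (Fin D → ℝ) → ℝ) (d e : Fin D) (x : Fin D → ℝ) : ℝ :=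
  fderiv ℝ (fun z => pd g e z) x (Pi.single d 1)

/-- The set of `α`-Hölder quotients of `φ : ℝ^D → ℝ`. -/
def hsemiSet {D : ℕ} (α : ℝ) (φ : (Fin D → ℝ) → ℝ) : Set ℝ :=
  {r | ∃ x y, x ≠ y ∧ r = |φ x - φ y| / en (x - y) ^ α}

/-- The set of parabolic `α`-Hölder quotients of `h` on `[0,T] × ℝ^D`. -/
def psemiSet {D : ℕ} (T α : ℝ) (h : ℝ → (Fin D → ℝ) → ℝ) : Set ℝ :=
  {r | ∃ t x s y, t ∈ Set.Icc (0:ℝ) T ∧ s ∈ Set.Icc (0:ℝ) T ∧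
    ((t, x) : ℝ × (Fin D → ℝ)) ≠ (s, y) ∧
    r = |h t x - h s y| / (Real.sqrt |t - s| + en (x - y)) ^ α}

open MeasureTheory

lemma en_nonneg {D : ℕ} (x : Fin D → ℝ) : 0 ≤ en x := Real.sqrt_nonneg _

lemma en_sq {D : ℕ} (x : Fin D → ℝ) : en x ^ 2 = x ⬝ᵥ x := by
  rw [en, Real.sq_sqrt (Finset.sum_nonneg fun i _ => sq_nonneg _)]
  simp [dotProduct, sq]

lemma en_smul {D : ℕ} (r : ℝ) (x : Fin D → ℝ) : en (r • x) = |r| * en x := by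
  rw [← abs_of_nonneg (en_nonneg (r • x)), ← abs_of_nonneg (en_nonneg x), ← abs_mul,
    ← sq_eq_sq_iff_abs_eq_abs, mul_pow, en_sq, en_sq]
  simp [sq, mul_assoc]

lemma abs_apply_le_en {D : ℕ} (x : Fin D → ℝ) (i : Fin D) : |x i| ≤ en x := by
  apply Real.abs_le_sqrt
  exact Finset.single_le_sum (f := fun i => x i ^ 2) (fun i _ => sq_nonneg _) (Finset.mem_univ i)

lemma norm_le_en {D : ℕ} (x : Fin D → ℝ) : ‖x‖ ≤ en x :=
  (pi_norm_le_iff_of_nonneg (en_nonneg x)).2 fun i => abs_apply_le_en x i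

lemma en_eq_zero {D : ℕ} {x : Fin D → ℝ} (h : en x = 0) : x = 0 := by
  have := norm_le_en x
  rw [h] at this
  exact norm_le_zero_iff.1 this

lemma dotProduct_le_en {D : ℕ} (x y : Fin D → ℝ) : x ⬝ᵥ y ≤ en x * en y :=
  Real.sum_mul_le_sqrt_mul_sqrt _ _ _

@[fun_prop]
lemma continuous_en {D : ℕ} : Continuous (en : (Fin D → ℝ) → ℝ) := by
  unfold en; fun_prop

/-- `S` is symmetric and its quadratic form lies between `a |y|²` and `b |y|²`, with `0 < a`. -/
structure EllM {D : ℕ} (S : Matrix (Fin D) (Fin D) ℝ) (a b : ℝ) : Prop where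
  pos : 0 < a
  pos' : 0 < b
  symm : Sᵀ = S
  lower : ∀ y, a * en y ^ 2 ≤ y ⬝ᵥ S *ᵥ y
  upper : ∀ y, y ⬝ᵥ S *ᵥ y ≤ b * en y ^ 2

namespace EllM
variable {D : ℕ} {S : Matrix (Fin D) (Fin D) ℝ} {a b : ℝ}

lemma posDef (h : EllM S a b) : S.PosDef := by
  refine Matrix.PosDef.of_dotProduct_mulVec_pos (by simpa [IsHermitian] using h.symm) fun x hx => ?_
  have h1 : 0 < en x := lt_of_le_of_ne (en_nonneg x) fun h0 => hx (en_eq_zero h0.symm)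
  have := h.lower x
  have h2 := h.pos
  simp only [star_trivial]
  exact lt_of_lt_of_le (by positivity) this

lemma det_pos (h : EllM S a b) : 0 < S.det := h.posDef.det_pos

lemma exists_factor (h : EllM S a b) : ∃ A : Matrix (Fin D) (Fin D) ℝ, S = A * Aᵀ ∧ A.det ≠ 0 ∧
    (∀ z, en (Aᵀ *ᵥ z) ^ 2 = z ⬝ᵥ S *ᵥ z) ∧ ∀ z, en (A *ᵥ z) ≤ √b * en z := by
  open scoped MatrixOrder in
  obtain ⟨B, hB⟩ := CStarAlgebra.nonneg_iff_eq_star_mul_self.mp h.posDef.posSemidef.nonneg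
  have hS : S = Bᵀ * B := by simpa [star_eq_conjTranspose] using hB
  have hq : ∀ z, en (B *ᵥ z) ^ 2 = z ⬝ᵥ S *ᵥ z := fun z => by
    rw [en_sq, hS, ← Matrix.mulVec_mulVec, Matrix.dotProduct_mulVec z Bᵀ, Matrix.vecMul_transpose]
  have hle : ∀ z, en (B *ᵥ z) ≤ √b * en z := fun z => by
    apply le_of_sq_le_sq _ (mul_nonneg (Real.sqrt_nonneg _) (en_nonneg _))
    rw [hq, mul_pow, Real.sq_sqrt h.pos'.le]
    exact h.upper z
  refine ⟨Bᵀ, by simpa using hS, ?_, by simpa using hq, fun z => ?_⟩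
  · intro h0
    have := h.det_pos
    rw [hS, det_mul, h0] at this
    simp at this
  · have h1 : en (Bᵀ *ᵥ z) ^ 2 ≤ en z * (√b * en (Bᵀ *ᵥ z)) := by
      rw [en_sq, ← Matrix.vecMul_transpose, transpose_transpose, ← Matrix.dotProduct_mulVec]
      exact (dotProduct_le_en _ _).trans (mul_le_mul_of_nonneg_left (hle _) (en_nonneg z))
    rcases (en_nonneg (Bᵀ *ᵥ z)).eq_or_lt with h0 | h0
    · rw [← h0]; exact mul_nonneg (Real.sqrt_nonneg _) (en_nonneg _)
    · nlinarith

lemma isUnit_det (h : EllM S a b) : IsUnit S.det := h.det_pos.ne'.isUnit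

lemma en_inv_mulVec_le (h : EllM S a b) (x : Fin D → ℝ) : en (S⁻¹ *ᵥ x) ≤ a⁻¹ * en x := by
  set w := S⁻¹ *ᵥ x
  have hx : x = S *ᵥ w := by simp [w, Matrix.mul_nonsing_inv _ h.isUnit_det]
  have h1 := (h.lower w).trans (dotProduct_le_en w (S *ᵥ w))
  rw [← hx] at h1
  rcases (en_nonneg w).eq_or_lt with h0 | h0
  · rw [← h0]; exact mul_nonneg (inv_nonneg.2 h.pos.le) (en_nonneg _)
  · rw [inv_mul_eq_div, le_div_iff₀ h.pos]
    nlinarith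

lemma inv_lower (h : EllM S a b) (x : Fin D → ℝ) : b⁻¹ * en x ^ 2 ≤ x ⬝ᵥ S⁻¹ *ᵥ x := by
  obtain ⟨A, hA, -, hq, hle⟩ := h.exists_factor
  set w := S⁻¹ *ᵥ x
  have hx : x = S *ᵥ w := by simp [w, Matrix.mul_nonsing_inv _ h.isUnit_det]
  have h1 := hle (Aᵀ *ᵥ w)
  rw [Matrix.mulVec_mulVec, ← hA, ← hx] at h1
  rw [dotProduct_comm, hx, ← hq, inv_mul_eq_div, div_le_iff₀ h.pos']
  rw [← hx]
  calc en x ^ 2 ≤ (√b * en (Aᵀ *ᵥ w)) ^ 2 := pow_le_pow_left₀ (en_nonneg _) h1 2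
    _ = _ := by rw [mul_pow, Real.sq_sqrt h.pos'.le]; ring

end EllM

/-- The centred Gaussian density with covariance matrix `S`. -/
def gk {D : ℕ} (S : Matrix (Fin D) (Fin D) ℝ) (y : Fin D → ℝ) : ℝ :=
  Real.exp (-(1/2) * (y ⬝ᵥ S⁻¹ *ᵥ y)) / ((2 * Real.pi) ^ ((D : ℝ) / 2) * √S.det)

lemma sum_eq_dotProduct {D : ℕ} (M : Matrix (Fin D) (Fin D) ℝ) (y : Fin D → ℝ) :
    ∑ i, ∑ j, y i * M i j * y j = y ⬝ᵥ M *ᵥ y := by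
  simp [dotProduct, mulVec, Finset.mul_sum, mul_assoc]

lemma Gam_eq_gk {D : ℕ} (C : ℝ → Matrix (Fin D) (Fin D) ℝ) (t s : ℝ) (y : Fin D → ℝ) :
    Gam C t s y = gk (Sig C t s) y := by
  rw [Gam, gk, sum_eq_dotProduct]

/-- The standard Gaussian density. -/
def stdg {D : ℕ} (z : Fin D → ℝ) : ℝ :=
  Real.exp (-(1/2) * en z ^ 2) / (2 * Real.pi) ^ ((D : ℝ) / 2)

lemma stdg_nonneg {D : ℕ} (z : Fin D → ℝ) : 0 ≤ stdg z := by unfold stdg; positivity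

lemma exp_en_eq_prod {D : ℕ} (b : ℝ) (z : Fin D → ℝ) :
    Real.exp (-b * en z ^ 2) = ∏ i, Real.exp (-b * z i ^ 2) := by
  rw [← Real.exp_sum, en_sq, ← Finset.mul_sum]
  simp [dotProduct, sq]

lemma integrable_exp_en {D : ℕ} {b : ℝ} (hb : 0 < b) :
    Integrable (fun z : Fin D → ℝ => Real.exp (-b * en z ^ 2)) := by
  simp_rw [exp_en_eq_prod]
  exact Integrable.fintype_prod fun _ => integrable_exp_neg_mul_sq hb

lemma integral_stdg {D : ℕ} : ∫ z : Fin D → ℝ, stdg z = 1 := by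
  unfold stdg
  rw [integral_div]
  simp_rw [exp_en_eq_prod]
  rw [integral_fintype_prod_volume_eq_pow (fun x : ℝ => Real.exp (-(1/2) * x ^ 2)),
    integral_gaussian, div_eq_one_iff_eq (by positivity), Real.sqrt_eq_rpow, ← Real.rpow_natCast,
    ← Real.rpow_mul (by positivity)]
  simp
  congr 1
  · ring
  · ring

/-- Polynomial factors are absorbed by halving a Gaussian exponent. -/
lemma exists_rpow_mul_exp_le {p b : ℝ} (hp : 0 ≤ p) (hb : 0 < b) :
    ∃ K, 0 ≤ K ∧ ∀ r, 0 ≤ r → r ^ p * Real.exp (-b * r ^ 2) ≤ K * Real.exp (-(b / 2) * r ^ 2) := by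
  obtain ⟨n, hn⟩ := exists_nat_ge p
  refine ⟨1 + n.factorial / (b / 2) ^ n, by positivity, fun r hr => ?_⟩
  have h1 : r ^ p ≤ 1 + (r ^ 2) ^ n := by
    rcases le_total r 1 with h | h
    · have := Real.rpow_le_one hr h hp
      have : 0 ≤ (r ^ 2) ^ n := by positivity
      linarith
    · have h2 : r ^ p ≤ r ^ (n : ℝ) := Real.rpow_le_rpow_of_exponent_le h hn
      rw [Real.rpow_natCast] at h2
      have h3 : r ^ n ≤ (r ^ 2) ^ n := pow_le_pow_left₀ hr (by nlinarith) n
      linarith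
  have h2 : (r ^ 2) ^ n ≤ n.factorial / (b / 2) ^ n * Real.exp (b / 2 * r ^ 2) := by
    have := Real.pow_div_factorial_le_exp (b / 2 * r ^ 2) (by positivity) n
    rw [div_le_iff₀ (by positivity), mul_pow] at this
    rw [div_mul_eq_mul_div, le_div_iff₀ (by positivity)]
    linarith
  have h3 : 1 ≤ Real.exp (b / 2 * r ^ 2) := Real.one_le_exp (by positivity)
  have h4 : Real.exp (-(b / 2) * r ^ 2) = Real.exp (b / 2 * r ^ 2) * Real.exp (-b * r ^ 2) := by
    rw [← Real.exp_add]; congr 1; ring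
  rw [h4, ← mul_assoc]
  gcongr
  linarith

lemma integrable_rpow_en_mul_stdg {D : ℕ} {p : ℝ} (hp : 0 ≤ p) :
    Integrable (fun z : Fin D → ℝ => stdg z * en z ^ p) := by
  obtain ⟨K, -, hK⟩ := exists_rpow_mul_exp_le hp (b := 1/2) (by norm_num)
  unfold stdg
  refine Integrable.mono' (((integrable_exp_en (D := D) (b := 1/2/2) (by norm_num)).const_mul K).div_const
    ((2 * Real.pi) ^ ((D : ℝ) / 2))) ?_ (Filter.Eventually.of_forall fun z => ?_)
  · apply Continuous.aestronglyMeasurable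
    have := continuous_en (D := D)
    have h2 : Continuous fun z : Fin D → ℝ => en z ^ p := this.rpow_const fun _ => Or.inr hp
    fun_prop
  · rw [Real.norm_of_nonneg (mul_nonneg (by positivity) (Real.rpow_nonneg (en_nonneg _) _)),
      div_mul_eq_mul_div]
    refine div_le_div_of_nonneg_right ?_ (by positivity)
    rw [mul_comm]
    exact hK _ (en_nonneg z)

/-- The `p`-th absolute moment of the standard Gaussian. -/
def mom (D : ℕ) (p : ℝ) : ℝ := ∫ z : Fin D → ℝ, stdg z * en z ^ p

lemma mom_nonneg (D : ℕ) (p : ℝ) : 0 ≤ mom D p :=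
  integral_nonneg fun z => mul_nonneg (stdg_nonneg z) (Real.rpow_nonneg (en_nonneg _) _)

lemma volume_map_mulVec {D : ℕ} {A : Matrix (Fin D) (Fin D) ℝ} (hA : A.det ≠ 0)
    (φ : (Fin D → ℝ) → ℝ) :
    (Integrable φ ↔ Integrable fun z => φ (A *ᵥ z)) ∧
      ∫ x, φ x = |A.det| * ∫ z, φ (A *ᵥ z) := by
  have hmap := Real.map_matrix_volume_pi_eq_smul_volume_pi hA
  have hemb : MeasurableEmbedding (A.toLin' : (Fin D → ℝ) → (Fin D → ℝ)) := by
    have h1 : Function.Injective (A.toLin' : (Fin D → ℝ) → (Fin D → ℝ)) := by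
      have := Matrix.mulVec_injective_iff_isUnit.2 ((Matrix.isUnit_iff_isUnit_det A).2 hA.isUnit)
      exact this
    exact (LinearMap.continuous_of_finiteDimensional _).measurableEmbedding h1
  have hpos : 0 < |A.det⁻¹| := abs_pos.2 (inv_ne_zero hA)
  constructor
  · have := hemb.integrable_map_iff (g := φ) (μ := volume)
    rw [hmap, integrable_smul_measure (by simpa using hA) (by simp)] at this
    exact this
  · have := hemb.integral_map (μ := volume) φ
    rw [hmap, integral_smul_measure, ENNReal.toReal_ofReal hpos.le] at this
    simp only [Matrix.toLin'_apply] at this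
    rw [← this, smul_eq_mul, ← mul_assoc, ← abs_mul, mul_inv_cancel₀ hA]
    simp

namespace EllM
variable {D : ℕ} {S : Matrix (Fin D) (Fin D) ℝ} {a b : ℝ}

lemma exists_change_of_variables (h : EllM S a b) : ∃ A : Matrix (Fin D) (Fin D) ℝ,
    (∀ z, en (A *ᵥ z) ≤ √b * en z) ∧ ∀ φ : (Fin D → ℝ) → ℝ,
      (Integrable (fun x => gk S x * φ x) ↔ Integrable fun z => stdg z * φ (A *ᵥ z)) ∧
      ∫ x, gk S x * φ x = ∫ z, stdg z * φ (A *ᵥ z) := by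
  obtain ⟨A, hA, hdet, hq, hle⟩ := h.exists_factor
  have hg : ∀ z, stdg z = |A.det| * gk S (A *ᵥ z) := fun z => by
    have hs : √S.det = |A.det| := by rw [hA, det_mul, det_transpose, ← sq, Real.sqrt_sq_eq_abs]
    have h1 : (A *ᵥ z) ⬝ᵥ S⁻¹ *ᵥ (A *ᵥ z) = en z ^ 2 := by
      have hu : IsUnit A.det := hdet.isUnit
      rw [hA, Matrix.mul_inv_rev, Matrix.mulVec_mulVec, Matrix.mul_assoc,
        Matrix.nonsing_inv_mul _ hu, Matrix.mul_one, en_sq, Matrix.dotProduct_mulVec,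
        ← Matrix.vecMul_transpose, Matrix.vecMul_vecMul, Matrix.mul_nonsing_inv _ (by simpa using hu),
        Matrix.vecMul_one]
    rw [stdg, gk, h1, hs]
    field_simp
  refine ⟨A, hle, fun φ => ?_⟩
  obtain ⟨h1, h2⟩ := volume_map_mulVec hdet fun x => gk S x * φ x
  simp_rw [hg, mul_assoc]
  rw [integral_const_mul, h2, h1, integrable_const_mul_iff (abs_pos.2 hdet).ne'.isUnit]
  exact ⟨Iff.rfl, rfl⟩

end EllM

lemma gk_nonneg {D : ℕ} (S : Matrix (Fin D) (Fin D) ℝ) (y : Fin D → ℝ) : 0 ≤ gk S y := by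
  unfold gk; positivity

lemma gk_neg {D : ℕ} (S : Matrix (Fin D) (Fin D) ℝ) (y : Fin D → ℝ) : gk S (-y) = gk S y := by
  simp [gk, Matrix.mulVec_neg]

@[fun_prop]
lemma continuous_gk {D : ℕ} (S : Matrix (Fin D) (Fin D) ℝ) : Continuous (gk S) := by
  unfold gk
  refine Continuous.div_const ?_ _
  have : Continuous fun y : Fin D → ℝ => y ⬝ᵥ S⁻¹ *ᵥ y :=
    continuous_id.dotProduct (continuous_const.matrix_mulVec continuous_id)
  fun_prop

lemma integral_gk_mul_odd {D : ℕ} (S : Matrix (Fin D) (Fin D) ℝ) {φ : (Fin D → ℝ) → ℝ}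
    (hφ : ∀ x, φ (-x) = -φ x) : ∫ x, gk S x * φ x = 0 := by
  have := integral_neg_eq_self (fun x => gk S x * φ x) volume
  simp only [gk_neg, hφ, mul_neg, integral_neg] at this
  linarith

lemma integral_translate {D : ℕ} (φ : (Fin D → ℝ) → (Fin D → ℝ) → ℝ) (y : Fin D → ℝ) :
    ∫ x, φ (x - y) x = ∫ x, φ x (y + x) := by
  rw [← integral_add_left_eq_self (fun x => φ (x - y) x) y]
  simp

lemma hasDerivAt_exp_quadratic (p q m r : ℝ) :
    HasDerivAt (fun r : ℝ => Real.exp (-(1/2) * (p - 2 * r * q + r ^ 2 * m)))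
      (Real.exp (-(1/2) * (p - 2 * r * q + r ^ 2 * m)) * (q - r * m)) r := by
  have h2 : HasDerivAt (fun r : ℝ => p - 2 * r * q + r ^ 2 * m) (-(2 * q) + 2 * r * m) r := by
    have := ((((hasDerivAt_id r).const_mul 2).mul_const q).const_sub p).add
      (((hasDerivAt_id r).pow 2).mul_const m)
    refine this.congr_deriv ?_
    simp
  refine (h2.const_mul (-(1/2))).exp.congr_deriv ?_
  ring

namespace EllM
variable {D : ℕ} {S : Matrix (Fin D) (Fin D) ℝ} {a b : ℝ}

lemma gk_le (h : EllM S a b) (x : Fin D → ℝ) :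
    gk S x ≤ Real.exp (-(b⁻¹ / 2) * en x ^ 2) / ((2 * Real.pi) ^ ((D : ℝ) / 2) * √S.det) := by
  unfold gk
  have := h.inv_lower x
  gcongr ?_ / _
  apply Real.exp_le_exp.2
  linarith

lemma integral_gk (h : EllM S a b) : ∫ x, gk S x = 1 := by
  obtain ⟨A, -, hA⟩ := h.exists_change_of_variables
  simpa [integral_stdg] using (hA fun _ => 1).2

lemma integrable_gk_mul_rpow (h : EllM S a b) {p : ℝ} (hp : 0 ≤ p) :
    Integrable (fun x => gk S x * en x ^ p) ∧ ∫ x, gk S x * en x ^ p ≤ √b ^ p * mom D p := by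
  obtain ⟨A, hle, hA⟩ := h.exists_change_of_variables
  have hle' : ∀ z, stdg z * en (A *ᵥ z) ^ p ≤ √b ^ p * (stdg z * en z ^ p) := fun z => by
    calc stdg z * en (A *ᵥ z) ^ p ≤ stdg z * (√b * en z) ^ p := by
          have := stdg_nonneg z
          gcongr
          · exact en_nonneg _
          · exact hle z
      _ = _ := by rw [Real.mul_rpow (Real.sqrt_nonneg _) (en_nonneg _)]; ring
  have hint := (integrable_rpow_en_mul_stdg (D := D) hp).const_mul (√b ^ p)
  have hi : Integrable fun z => stdg z * en (A *ᵥ z) ^ p := by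
    refine hint.mono' ?_ (Filter.Eventually.of_forall fun z => ?_)
    · apply Continuous.aestronglyMeasurable
      have h1 : Continuous fun z : Fin D → ℝ => en (A *ᵥ z) ^ p :=
        (continuous_en.comp (continuous_const.matrix_mulVec continuous_id)).rpow_const
          fun _ => Or.inr hp
      unfold stdg
      fun_prop
    · rw [Real.norm_of_nonneg (mul_nonneg (stdg_nonneg z) (Real.rpow_nonneg (en_nonneg _) _))]
      exact hle' z
  refine ⟨(hA _).1.2 hi, ?_⟩
  rw [(hA _).2, mom, ← integral_const_mul]
  exact integral_mono hi hint hle'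

lemma integrable_gk (h : EllM S a b) : Integrable (gk S) := by
  simpa using (h.integrable_gk_mul_rpow le_rfl).1

lemma abs_inv_mulVec_le (h : EllM S a b) (x : Fin D → ℝ) (d : Fin D) :
    |(S⁻¹ *ᵥ x) d| ≤ a⁻¹ * en x :=
  (abs_apply_le_en _ d).trans (h.en_inv_mulVec_le x)

lemma hasDerivAt_gk_line (h : EllM S a b) (w : Fin D → ℝ) (d : Fin D) (r : ℝ) :
    HasDerivAt (fun r : ℝ => gk S (w - r • Pi.single d 1))
      (gk S (w - r • Pi.single d 1) * (S⁻¹ *ᵥ (w - r • Pi.single d 1)) d) r := by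
  have hsymm : S⁻¹ᵀ = S⁻¹ := by rw [Matrix.transpose_nonsing_inv, h.symm]
  have hlin : ∀ r : ℝ, (S⁻¹ *ᵥ (w - r • Pi.single d 1)) d = (S⁻¹ *ᵥ w) d - r * S⁻¹ d d := fun r => by
    simp [Matrix.mulVec_sub, Matrix.mulVec_smul]
  have hq : ∀ r : ℝ, (w - r • Pi.single d 1) ⬝ᵥ S⁻¹ *ᵥ (w - r • Pi.single d 1) =
      w ⬝ᵥ S⁻¹ *ᵥ w - 2 * r * (S⁻¹ *ᵥ w) d + r ^ 2 * S⁻¹ d d := fun r => by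
    have h1 : w ⬝ᵥ S⁻¹ *ᵥ Pi.single d 1 = (S⁻¹ *ᵥ w) d := by
      rw [Matrix.dotProduct_mulVec, ← Matrix.mulVec_transpose, hsymm]
      simp
    rw [sub_dotProduct, smul_dotProduct, single_dotProduct, hlin, Matrix.mulVec_sub,
      Matrix.mulVec_smul, dotProduct_sub, dotProduct_smul, h1]
    simp only [smul_eq_mul]
    ring
  unfold gk
  simp_rw [hq, hlin]
  refine ((hasDerivAt_exp_quadratic (w ⬝ᵥ S⁻¹ *ᵥ w) ((S⁻¹ *ᵥ w) d) (S⁻¹ d d) r).div_const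
    ((2 * Real.pi) ^ ((D : ℝ) / 2) * √S.det)).congr_deriv ?_
  ring

lemma exists_deriv_gk_bound (h : EllM S a b) (d : Fin D) : ∃ K c, 0 < c ∧
    ∀ (w : Fin D → ℝ) (r : ℝ), |r| < 1 →
      gk S (w - r • Pi.single d 1) * |(S⁻¹ *ᵥ (w - r • Pi.single d 1)) d| ≤
        K * Real.exp (-c * en w ^ 2) := by
  have hb := h.pos'
  have ha := h.pos
  set N := (2 * Real.pi) ^ ((D : ℝ) / 2) * √S.det with hN
  have hNpos : 0 < N := by have := h.det_pos; positivity
  obtain ⟨K, hK0, hK⟩ := exists_rpow_mul_exp_le (p := 1) (b := b⁻¹ / 2) zero_le_one (by positivity)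
  refine ⟨a⁻¹ * K / N * Real.exp (b⁻¹ / 2 / 2), b⁻¹ / 2 / 2 / 2, by positivity,
    fun w₀ r hr => ?_⟩
  set w := w₀ - r • Pi.single d 1 with hw
  have hww : w₀ ⬝ᵥ w₀ ≤ 2 * (w ⬝ᵥ w) + 2 := by
    have e1 : w₀ = w + r • Pi.single d 1 := by simp [hw]
    have e2 : w₀ ⬝ᵥ w₀ = w ⬝ᵥ w + 2 * r * w d + r ^ 2 := by
      rw [e1]
      simp only [add_dotProduct, dotProduct_add, smul_dotProduct, dotProduct_smul,
        single_dotProduct, dotProduct_single]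
      simp
      ring
    have e3 := abs_le.1 (abs_apply_le_en w d)
    have e4 := en_sq w
    have e5 : w d ^ 2 ≤ en w ^ 2 := sq_le_sq' (by linarith) e3.2
    have e6 : r ^ 2 ≤ 1 := (sq_le_one_iff_abs_le_one r).2 hr.le
    nlinarith [sq_nonneg (w d - r)]
  rw [← en_sq, ← en_sq] at hww
  have e1 := h.abs_inv_mulVec_le w d
  have e2 := h.gk_le w
  have e3 := hK (en w) (en_nonneg w)
  rw [Real.rpow_one] at e3
  have e4 : Real.exp (-(b⁻¹ / 2 / 2) * en w ^ 2) ≤ Real.exp (b⁻¹ / 2 / 2) *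
      Real.exp (-(b⁻¹ / 2 / 2 / 2) * en w₀ ^ 2) := by
    rw [← Real.exp_add]
    apply Real.exp_le_exp.2
    have : 0 < b⁻¹ := by positivity
    nlinarith
  calc gk S w * |(S⁻¹ *ᵥ w) d|
      ≤ (Real.exp (-(b⁻¹ / 2) * en w ^ 2) / N) * (a⁻¹ * en w) := by
        have := gk_nonneg S w
        have := en_nonneg w
        gcongr
    _ = a⁻¹ / N * (en w * Real.exp (-(b⁻¹ / 2) * en w ^ 2)) := by ring
    _ ≤ a⁻¹ / N * (K * (Real.exp (b⁻¹ / 2 / 2) *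
        Real.exp (-(b⁻¹ / 2 / 2 / 2) * en w₀ ^ 2))) := by
        refine mul_le_mul_of_nonneg_left ?_ (by positivity)
        exact e3.trans (mul_le_mul_of_nonneg_left e4 hK0)
    _ = _ := by ring

lemma hasDerivAt_integral_gk (h : EllM S a b) {φ : (Fin D → ℝ) → ℝ} {M : ℝ}
    (hφ : AEStronglyMeasurable φ) (hM : ∀ x, |φ x| ≤ M) (y : Fin D → ℝ) (d : Fin D) (r₀ : ℝ) :
    HasDerivAt (fun r : ℝ => ∫ x, gk S (x - (y + r • Pi.single d 1)) * φ x)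
      (∫ x, gk S (x - (y + r₀ • Pi.single d 1)) * (S⁻¹ *ᵥ (x - (y + r₀ • Pi.single d 1))) d * φ x)
      r₀ := by
  obtain ⟨K, c, hc, hK⟩ := h.exists_deriv_gk_bound d
  have hmeas : ∀ r : ℝ, AEStronglyMeasurable fun x => gk S (x - (y + r • Pi.single d 1)) * φ x :=
    fun r => AEStronglyMeasurable.mul (Continuous.aestronglyMeasurable (by fun_prop)) hφ
  have hint : Integrable fun x => gk S (x - (y + r₀ • Pi.single d 1)) * φ x := by
    refine ((h.integrable_gk.comp_sub_right (y + r₀ • Pi.single d 1)).mul_const M).mono' (hmeas r₀)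
      (Filter.Eventually.of_forall fun x => ?_)
    rw [norm_mul, Real.norm_of_nonneg (gk_nonneg _ _)]
    exact mul_le_mul_of_nonneg_left (hM x) (gk_nonneg _ _)
  have hmeas' : AEStronglyMeasurable fun x => gk S (x - (y + r₀ • Pi.single d 1)) *
      (S⁻¹ *ᵥ (x - (y + r₀ • Pi.single d 1))) d * φ x := by
    refine AEStronglyMeasurable.mul (Continuous.aestronglyMeasurable ?_) hφ
    have : Continuous fun x : Fin D → ℝ => S⁻¹ *ᵥ (x - (y + r₀ • Pi.single d 1)) :=
      continuous_const.matrix_mulVec (by fun_prop)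
    fun_prop
  have hbound : ∀ x, ∀ r ∈ Metric.ball r₀ 1, ‖gk S (x - (y + r • Pi.single d 1)) *
      (S⁻¹ *ᵥ (x - (y + r • Pi.single d 1))) d * φ x‖ ≤
      K * Real.exp (-c * en (x - (y + r₀ • Pi.single d 1)) ^ 2) * M := fun x r hr => by
    rw [norm_mul, norm_mul, Real.norm_of_nonneg (gk_nonneg _ _)]
    have hr1 : |r - r₀| < 1 := by simpa [Real.dist_eq] using hr
    have e1 : x - (y + r • Pi.single d 1) =
        x - (y + r₀ • Pi.single d 1) - (r - r₀) • Pi.single d 1 := by module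
    rw [e1]
    have := hK (x - (y + r₀ • Pi.single d 1)) (r - r₀) hr1
    exact mul_le_mul this (hM x) (abs_nonneg _)
      ((mul_nonneg (gk_nonneg _ _) (abs_nonneg _)).trans this)
  have hbint : Integrable fun x : Fin D → ℝ =>
      K * Real.exp (-c * en (x - (y + r₀ • Pi.single d 1)) ^ 2) * M :=
    (((integrable_exp_en hc).comp_sub_right _).const_mul K).mul_const M
  have hderiv : ∀ x, ∀ r ∈ Metric.ball r₀ 1, HasDerivAt
      (fun r : ℝ => gk S (x - (y + r • Pi.single d 1)) * φ x) (gk S (x - (y + r • Pi.single d 1)) *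
      (S⁻¹ *ᵥ (x - (y + r • Pi.single d 1))) d * φ x) r := fun x r _ => by
    simp only [← sub_sub]
    exact (h.hasDerivAt_gk_line (x - y) d r).mul_const (φ x)
  have key := hasDerivAt_integral_of_dominated_loc_of_deriv_le (𝕜 := ℝ) (μ := volume)
    (Metric.ball_mem_nhds r₀ one_pos) (Filter.Eventually.of_forall hmeas) hint hmeas'
    (Filter.Eventually.of_forall hbound) hbint (Filter.Eventually.of_forall hderiv)
  exact key.2

/-- Bound for the derivative of a Gaussian average of a bounded function. -/
lemma abs_integral_deriv_gk_le (h : EllM S a b) {φ : (Fin D → ℝ) → ℝ} {M : ℝ}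
    (hM : ∀ x, |φ x| ≤ M) (y : Fin D → ℝ) (d : Fin D) :
    |∫ x, gk S (x - y) * (S⁻¹ *ᵥ (x - y)) d * φ x| ≤ M * a⁻¹ * (√b * mom D 1) := by
  have hM0 : 0 ≤ M := (abs_nonneg _).trans (hM 0)
  have ha := h.pos
  rw [integral_translate (fun w x => gk S w * (S⁻¹ *ᵥ w) d * φ x) y]
  obtain ⟨h1, h2⟩ := h.integrable_gk_mul_rpow zero_le_one
  simp only [Real.rpow_one] at h1 h2
  rw [← Real.norm_eq_abs]
  refine (norm_integral_le_of_norm_le (h1.const_mul (M * a⁻¹))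
    (Filter.Eventually.of_forall fun x => ?_)).trans ?_
  · rw [norm_mul, norm_mul, Real.norm_of_nonneg (gk_nonneg _ _)]
    calc gk S x * ‖(S⁻¹ *ᵥ x) d‖ * ‖φ (y + x)‖ ≤ gk S x * (a⁻¹ * en x) * M := by
          have := gk_nonneg S x
          have := en_nonneg x
          gcongr
          · exact h.abs_inv_mulVec_le x d
          · exact hM _
      _ = _ := by ring
  · rw [integral_const_mul]
    gcongr

/-- Bound for the derivative of a Gaussian average of a Hölder continuous function. -/
lemma abs_integral_deriv_gk_le_of_holder (h : EllM S a b) {φ : (Fin D → ℝ) → ℝ} {M H α : ℝ}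
    (hφ : AEStronglyMeasurable φ) (hM : ∀ x, |φ x| ≤ M) (hα : 0 ≤ α) (hH : 0 ≤ H) (y : Fin D → ℝ)
    (hφH : ∀ x, |φ x - φ y| ≤ H * en (x - y) ^ α) (d : Fin D) :
    |∫ x, gk S (x - y) * (S⁻¹ *ᵥ (x - y)) d * φ x| ≤
      H * a⁻¹ * (√b ^ (1 + α) * mom D (1 + α)) := by
  have hM0 : 0 ≤ M := (abs_nonneg _).trans (hM 0)
  have ha := h.pos
  rw [integral_translate (fun w x => gk S w * (S⁻¹ *ᵥ w) d * φ x) y]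
  obtain ⟨h3, -⟩ := h.integrable_gk_mul_rpow zero_le_one
  simp only [Real.rpow_one] at h3
  obtain ⟨h1, h2⟩ := h.integrable_gk_mul_rpow (p := 1 + α) (by positivity)
  have hcont : Continuous fun x : Fin D → ℝ => gk S x * (S⁻¹ *ᵥ x) d := by
    have : Continuous fun x : Fin D → ℝ => S⁻¹ *ᵥ x :=
      continuous_const.matrix_mulVec (by fun_prop)
    fun_prop
  have hbd : ∀ x, ‖gk S x * (S⁻¹ *ᵥ x) d‖ ≤ a⁻¹ * (gk S x * en x) := fun x => by
    rw [norm_mul, Real.norm_of_nonneg (gk_nonneg _ _)]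
    have := mul_le_mul_of_nonneg_left (h.abs_inv_mulVec_le x d) (gk_nonneg S x)
    rw [Real.norm_eq_abs]
    linarith
  have hi1 : Integrable fun x => gk S x * (S⁻¹ *ᵥ x) d :=
    (h3.const_mul a⁻¹).mono' hcont.aestronglyMeasurable (Filter.Eventually.of_forall hbd)
  have hi2 : Integrable fun x => gk S x * (S⁻¹ *ᵥ x) d * φ (y + x) :=
    hi1.mul_bdd (c := M) (hφ.comp_measurePreserving (measurePreserving_add_left volume y))
      (Filter.Eventually.of_forall fun x => hM _)
  have hz : ∫ x, gk S x * (S⁻¹ *ᵥ x) d = 0 :=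
    integral_gk_mul_odd S fun x => by simp [Matrix.mulVec_neg]
  have heq : ∫ x, gk S x * (S⁻¹ *ᵥ x) d * φ (y + x) =
      ∫ x, gk S x * (S⁻¹ *ᵥ x) d * (φ (y + x) - φ y) := by
    simp_rw [mul_sub]
    rw [integral_sub hi2 (hi1.mul_const _), integral_mul_const, hz]
    simp
  rw [heq]
  rw [← Real.norm_eq_abs]
  refine (norm_integral_le_of_norm_le (h1.const_mul (H * a⁻¹))
    (Filter.Eventually.of_forall fun x => ?_)).trans ?_
  · rw [norm_mul]
    rcases (en_nonneg x).eq_or_lt with h0 | h0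
    · rw [en_eq_zero h0.symm]
      simp only [mulVec_zero, Pi.zero_apply, mul_zero, norm_zero, zero_mul]
      exact mul_nonneg (by positivity) (mul_nonneg (gk_nonneg _ _) (Real.rpow_nonneg (en_nonneg _) _))
    calc ‖gk S x * (S⁻¹ *ᵥ x) d‖ * ‖φ (y + x) - φ y‖ ≤ a⁻¹ * (gk S x * en x) * (H * en x ^ α) := by
          have := gk_nonneg S x
          gcongr
          · exact hbd x
          · simpa using hφH (y + x)
      _ = _ := by rw [Real.rpow_add h0, Real.rpow_one]; ring
  · rw [integral_const_mul]
    gcongr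

end EllM

lemma fderiv_apply_eq_sum_pd {D : ℕ} (g : (Fin D → ℝ) → ℝ) (x v : Fin D → ℝ) :
    fderiv ℝ g x v = ∑ i, v i * pd g i x := by
  conv_lhs => rw [← Finset.univ_sum_single v]
  rw [map_sum]
  refine Finset.sum_congr rfl fun i _ => ?_
  have : Pi.single i (v i) = v i • (Pi.single i 1 : Fin D → ℝ) := by
    rw [← Pi.single_smul', smul_eq_mul, mul_one]
  rw [this, map_smul, pd, smul_eq_mul]

lemma abs_sub_le_of_abs_pd_le {D : ℕ} {g : (Fin D → ℝ) → ℝ} (hg : Differentiable ℝ g) {M : ℝ}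
    (hM : ∀ x d, |pd g d x| ≤ M) (x y : Fin D → ℝ) : |g y - g x| ≤ D * M * en (y - x) := by
  rcases D.eq_zero_or_pos with rfl | hD
  · have : y = x := Subsingleton.elim _ _
    simp [this]
  have hM0 : 0 ≤ M := (abs_nonneg _).trans (hM 0 ⟨0, hD⟩)
  have h1 : ∀ z ∈ (Set.univ : Set (Fin D → ℝ)), ‖fderiv ℝ g z‖ ≤ D * M := fun z _ => by
    refine ContinuousLinearMap.opNorm_le_bound _ (by positivity) fun v => ?_
    rw [fderiv_apply_eq_sum_pd]
    refine (norm_sum_le _ _).trans ((Finset.sum_le_card_nsmul _ _ (M * ‖v‖) fun i _ => ?_).trans ?_)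
    · rw [norm_mul, mul_comm]
      exact mul_le_mul (hM z i) (norm_le_pi_norm v i) (norm_nonneg _) hM0
    · simp [mul_assoc]
  refine (convex_univ.norm_image_sub_le_of_norm_fderiv_le (fun z _ => hg z) h1 (Set.mem_univ x)
    (Set.mem_univ y)).trans ?_
  exact mul_le_mul_of_nonneg_left (norm_le_en _) (by positivity)

lemma contDiff_pd {D : ℕ} {g : (Fin D → ℝ) → ℝ} (hg : ContDiff ℝ 2 g) (d : Fin D) :
    ContDiff ℝ 1 (pd g d) := by
  have : ContDiff ℝ 1 (fderiv ℝ g) := hg.fderiv_right (by norm_num)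
  exact this.clm_apply contDiff_const

lemma hasDerivAt_along_line {D : ℕ} {g : (Fin D → ℝ) → ℝ} (hg : Differentiable ℝ g)
    (y v : Fin D → ℝ) (r : ℝ) :
    HasDerivAt (fun r : ℝ => g (y + r • v)) (fderiv ℝ g (y + r • v) v) r := by
  have h1 : HasDerivAt (fun r : ℝ => y + r • v) v r := by
    simpa using ((hasDerivAt_id r).smul_const v).const_add y
  exact (hg _).hasFDerivAt.comp_hasDerivAt r h1

/-- First-order Taylor estimate for a function with Hölder continuous partial derivatives. -/
lemma abs_taylor_remainder_le {D : ℕ} {q : (Fin D → ℝ) → ℝ} (hq : Differentiable ℝ q) {α : ℝ}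
    (hα : 0 ≤ α) {H : Fin D → ℝ}
    (hH : ∀ e x y, |pd q e x - pd q e y| ≤ H e * en (x - y) ^ α) (hH0 : ∀ e, 0 ≤ H e)
    (x y : Fin D → ℝ) :
    |q (y + x) - q y - ∑ e, x e * pd q e y| ≤ (∑ e, H e) * (en x * en x ^ α) := by
  obtain ⟨r, hr, hr'⟩ := exists_hasDerivAt_eq_slope (fun r : ℝ => q (y + r • x))
    (fun r => fderiv ℝ q (y + r • x) x) zero_lt_one
    (fun r _ => (hasDerivAt_along_line hq y x r).continuousAt.continuousWithinAt)
    (fun r _ => hasDerivAt_along_line hq y x r)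
  simp only [one_smul, zero_smul, add_zero, sub_zero, div_one] at hr'
  rw [← hr', fderiv_apply_eq_sum_pd, ← Finset.sum_sub_distrib, Finset.sum_mul]
  refine (Finset.abs_sum_le_sum_abs _ _).trans (Finset.sum_le_sum fun e _ => ?_)
  rw [← mul_sub, abs_mul]
  have h1 := hH e (y + r • x) y
  rw [add_sub_cancel_left, en_smul, abs_of_pos hr.1] at h1
  have h2 : (r * en x) ^ α ≤ en x ^ α := by
    refine Real.rpow_le_rpow (mul_nonneg hr.1.le (en_nonneg _)) ?_ hα
    exact mul_le_of_le_one_left (en_nonneg _) hr.2.le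
  calc |x e| * |pd q e (y + r • x) - pd q e y| ≤ en x * (H e * en x ^ α) :=
        mul_le_mul (abs_apply_le_en x e) (h1.trans (mul_le_mul_of_nonneg_left h2 (hH0 e)))
          (abs_nonneg _) (en_nonneg _)
    _ = _ := by ring

namespace EllM
variable {D : ℕ} {S : Matrix (Fin D) (Fin D) ℝ} {a b : ℝ}

lemma hasDerivAt_integral_gk_of_contDiff (h : EllM S a b) {g : (Fin D → ℝ) → ℝ}
    (hg : ContDiff ℝ 1 g) {M : ℝ} (hM : ∀ x d, |pd g d x| ≤ M) (y : Fin D → ℝ) (d : Fin D) :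
    HasDerivAt (fun r : ℝ => ∫ x, gk S (x - (y + r • Pi.single d 1)) * g x)
      (∫ x, gk S x * pd g d (y + x)) 0 := by
  have hgd : Differentiable ℝ g := hg.differentiable one_ne_zero
  have hgc : Continuous g := hg.continuous
  have hpc : Continuous (pd g d) := (hg.continuous_fderiv one_ne_zero).clm_apply continuous_const
  have htr : ∀ r : ℝ, ∫ x, gk S (x - (y + r • Pi.single d 1)) * g x =
      ∫ x, gk S x * g (y + r • Pi.single d 1 + x) := fun r =>
    integral_translate (fun w x => gk S w * g x) _
  simp_rw [htr]
  have hmeas : ∀ r : ℝ, AEStronglyMeasurable fun x => gk S x * g (y + r • Pi.single d 1 + x) :=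
    fun r => Continuous.aestronglyMeasurable (by fun_prop)
  have hmeas' : AEStronglyMeasurable fun x => gk S x * pd g d (y + (0:ℝ) • Pi.single d 1 + x) :=
    Continuous.aestronglyMeasurable (by fun_prop)
  obtain ⟨h1, -⟩ := h.integrable_gk_mul_rpow zero_le_one
  simp only [Real.rpow_one] at h1
  have hint : Integrable fun x => gk S x * g (y + (0:ℝ) • Pi.single d 1 + x) := by
    refine ((h.integrable_gk.mul_const |g y|).add (h1.mul_const (D * M))).mono' (hmeas 0)
      (Filter.Eventually.of_forall fun x => ?_)
    have h2 := abs_sub_le_of_abs_pd_le hgd hM y (y + x)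
    rw [add_sub_cancel_left] at h2
    have h3 : |g (y + x)| ≤ |g y| + D * M * en x := by
      have := abs_sub_abs_le_abs_sub (g (y + x)) (g y)
      linarith
    simp only [zero_smul, add_zero, norm_mul, Real.norm_eq_abs, abs_of_nonneg (gk_nonneg S x),
      Pi.add_apply]
    have := mul_le_mul_of_nonneg_left h3 (gk_nonneg S x)
    linarith
  have hbound : ∀ x, ∀ r ∈ Metric.ball (0:ℝ) 1,
      ‖gk S x * pd g d (y + r • Pi.single d 1 + x)‖ ≤ gk S x * M := fun x r _ => by
    rw [norm_mul, Real.norm_of_nonneg (gk_nonneg _ _)]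
    exact mul_le_mul_of_nonneg_left (hM _ d) (gk_nonneg _ _)
  have hderiv : ∀ x, ∀ r ∈ Metric.ball (0:ℝ) 1, HasDerivAt
      (fun r : ℝ => gk S x * g (y + r • Pi.single d 1 + x))
      (gk S x * pd g d (y + r • Pi.single d 1 + x)) r := fun x r _ => by
    simp only [add_right_comm y]
    exact (hasDerivAt_along_line hgd (y + x) (Pi.single d 1) r).const_mul _
  have key := hasDerivAt_integral_of_dominated_loc_of_deriv_le (𝕜 := ℝ) (μ := volume)
    (Metric.ball_mem_nhds 0 one_pos) (Filter.Eventually.of_forall hmeas) hint hmeas'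
    (Filter.Eventually.of_forall hbound) (h.integrable_gk.mul_const M)
    (Filter.Eventually.of_forall hderiv)
  simpa using key.2

lemma abs_integral_gk_sub_le (h : EllM S a b) {q : (Fin D → ℝ) → ℝ} (hq : ContDiff ℝ 1 q) {M α : ℝ}
    (hM : ∀ x, |q x| ≤ M) (hα : 0 ≤ α) {H : Fin D → ℝ}
    (hH : ∀ e x y, |pd q e x - pd q e y| ≤ H e * en (x - y) ^ α) (hH0 : ∀ e, 0 ≤ H e)
    (y : Fin D → ℝ) :
    |(∫ x, gk S x * q (y + x)) - q y| ≤ (∑ e, H e) * (√b ^ (1 + α) * mom D (1 + α)) := by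
  have hqc := hq.continuous
  obtain ⟨h3, -⟩ := h.integrable_gk_mul_rpow zero_le_one
  simp only [Real.rpow_one] at h3
  obtain ⟨h1, h2⟩ := h.integrable_gk_mul_rpow (p := 1 + α) (by positivity)
  have hi1 : Integrable fun x => gk S x * q (y + x) :=
    h.integrable_gk.mul_bdd (c := M) (Continuous.aestronglyMeasurable (by fun_prop))
      (Filter.Eventually.of_forall fun x => hM _)
  have hi2 : Integrable fun x => gk S x * q y := h.integrable_gk.mul_const _
  have hi3 : Integrable fun x => gk S x * ∑ e, x e * pd q e y := by
    simp_rw [Finset.mul_sum, ← mul_assoc]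
    refine integrable_finsetSum _ fun e _ => Integrable.mul_const ?_ _
    refine h3.mono' (Continuous.aestronglyMeasurable (by fun_prop))
      (Filter.Eventually.of_forall fun x => ?_)
    rw [norm_mul, Real.norm_of_nonneg (gk_nonneg _ _)]
    exact mul_le_mul_of_nonneg_left (abs_apply_le_en x e) (gk_nonneg _ _)
  have hz : ∫ x, gk S x * ∑ e, x e * pd q e y = 0 :=
    integral_gk_mul_odd S fun x => by simp
  have heq : (∫ x, gk S x * q (y + x)) - q y =
      ∫ x, gk S x * (q (y + x) - q y - ∑ e, x e * pd q e y) := by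
    simp_rw [mul_sub]
    have hi12 : Integrable fun x => gk S x * q (y + x) - gk S x * q y := hi1.sub hi2
    rw [integral_sub hi12 hi3, integral_sub hi1 hi2, hz, integral_mul_const, h.integral_gk]
    ring
  have hH0' : 0 ≤ ∑ e, H e := Finset.sum_nonneg fun e _ => hH0 e
  rw [heq, ← Real.norm_eq_abs]
  refine (norm_integral_le_of_norm_le (h1.const_mul (∑ e, H e))
    (Filter.Eventually.of_forall fun x => ?_)).trans ?_
  · rw [norm_mul, Real.norm_of_nonneg (gk_nonneg _ _)]
    have := abs_taylor_remainder_le (hq.differentiable one_ne_zero) hα hH hH0 x y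
    have h4 : en x * en x ^ α ≤ en x ^ (1 + α) := by
      rcases (en_nonneg x).eq_or_lt with h0 | h0
      · rw [← h0, zero_mul]; exact Real.rpow_nonneg le_rfl _
      · rw [Real.rpow_add h0, Real.rpow_one]
    calc gk S x * ‖q (y + x) - q y - ∑ e, x e * pd q e y‖
        ≤ gk S x * ((∑ e, H e) * en x ^ (1 + α)) := by
          have := gk_nonneg S x
          gcongr
          exact (‹|_| ≤ _› : |q (y + x) - q y - ∑ e, x e * pd q e y| ≤ _).trans
            (mul_le_mul_of_nonneg_left h4 hH0')
      _ = _ := by ring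
  · rw [integral_const_mul]
    gcongr

end EllM

section Sig
variable {D : ℕ} {C : ℝ → Matrix (Fin D) (Fin D) ℝ} {δ δ' : ℝ}

lemma continuous_mul_transpose_apply (hC : Continuous C) (i j : Fin D) :
    Continuous fun u => (C u * (C u)ᵀ) i j :=
  (hC.matrix_mul hC.matrix_transpose).matrix_elem i j

lemma dotProduct_Sig_mulVec (hC : Continuous C) (t s : ℝ) (y : Fin D → ℝ) :
    y ⬝ᵥ Sig C t s *ᵥ y = ∫ u in t..s, ∑ i, ∑ j, y i * (C u * (C u)ᵀ) i j * y j := by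
  have hc := continuous_mul_transpose_apply hC
  rw [intervalIntegral.integral_finsetSum, ← sum_eq_dotProduct]
  · refine Finset.sum_congr rfl fun i _ => ?_
    rw [intervalIntegral.integral_finsetSum]
    · refine Finset.sum_congr rfl fun j _ => ?_
      rw [intervalIntegral.integral_mul_const, intervalIntegral.integral_const_mul, Sig]
    · intro j _
      exact (((hc i j).const_mul (y i)).mul_const (y j)).intervalIntegrable _ _
  · intro i _
    refine Continuous.intervalIntegrable ?_ _ _
    exact continuous_finsetSum _ fun j _ => ((hc i j).const_mul (y i)).mul_const (y j)

lemma ellM_Sig (hδ : 0 < δ) (hδδ : δ ≤ δ') (hC : Continuous C) (hE : Ellip D δ δ' C) {t s : ℝ}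
    (ht : 0 ≤ t) (hts : t < s) (hs : s ≤ 1) :
    EllM (Sig C t s) (δ * (s - t)) (δ' * (s - t)) := by
  have hτ : 0 < s - t := sub_pos.2 hts
  have hc := continuous_mul_transpose_apply hC
  have hint : ∀ y : Fin D → ℝ, IntervalIntegrable
      (fun u => ∑ i, ∑ j, y i * (C u * (C u)ᵀ) i j * y j) volume t s := fun y => by
    refine Continuous.intervalIntegrable ?_ _ _
    exact continuous_finsetSum _ fun i _ => continuous_finsetSum _ fun j _ =>
      ((hc i j).const_mul (y i)).mul_const (y j)
  have hen : ∀ y : Fin D → ℝ, en y ^ 2 = ∑ i, y i ^ 2 := fun y => by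
    rw [en_sq]; simp [dotProduct, sq]
  refine ⟨by positivity, mul_pos (hδ.trans_le hδδ) hτ, ?_, fun y => ?_, fun y => ?_⟩
  · ext i j
    simp only [transpose_apply, Sig]
    refine intervalIntegral.integral_congr fun u _ => ?_
    simp only [Matrix.mul_apply, transpose_apply, mul_comm]
  · rw [dotProduct_Sig_mulVec hC]
    have := intervalIntegral.integral_mono_on hts.le
      (f := fun _ => δ * en y ^ 2) intervalIntegrable_const (hint y) fun u hu => by
        rw [hen]; exact (hE u ⟨ht.trans hu.1, hu.2.trans hs⟩ y).1
    rw [intervalIntegral.integral_const, smul_eq_mul] at this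
    linarith
  · rw [dotProduct_Sig_mulVec hC]
    have := intervalIntegral.integral_mono_on hts.le (hint y)
      (g := fun _ => δ' * en y ^ 2) intervalIntegrable_const fun u hu => by
        rw [hen]; exact (hE u ⟨ht.trans hu.1, hu.2.trans hs⟩ y).2
    rw [intervalIntegral.integral_const, smul_eq_mul] at this
    linarith

lemma continuous_Sig (hC : Continuous C) (t : ℝ) : Continuous (Sig C t) :=
  continuous_matrix fun i j => intervalIntegral.continuous_primitive
    (fun _ _ => (continuous_mul_transpose_apply hC i j).intervalIntegrable _ _) t

lemma continuousOn_Sig_inv (hC : Continuous C) {t : ℝ} {I : Set ℝ}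
    (hI : ∀ s ∈ I, (Sig C t s).det ≠ 0) : ContinuousOn (fun s => (Sig C t s)⁻¹) I := by
  have h1 := continuous_Sig hC t
  simp_rw [Matrix.inv_def, Ring.inverse_eq_inv']
  exact (h1.matrix_det.continuousOn.inv₀ hI).smul h1.matrix_adjugate.continuousOn

lemma continuousOn_Sig_inv_apply (hC : Continuous C) {t : ℝ} {I : Set ℝ}
    (hI : ∀ s ∈ I, 0 < (Sig C t s).det) (i j : Fin D) :
    ContinuousOn (fun p : ℝ × (Fin D → ℝ) => (Sig C t p.1)⁻¹ i j) (I ×ˢ Set.univ) :=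
  ((continuous_apply_apply i j).comp_continuousOn
    (continuousOn_Sig_inv hC fun s hs => (hI s hs).ne')).comp continuousOn_fst fun _ hp => hp.1

lemma continuous_snd_sub_apply (y : Fin D → ℝ) (i : Fin D) :
    Continuous fun p : ℝ × (Fin D → ℝ) => (p.2 - y) i :=
  (continuous_apply i).comp (continuous_snd.sub continuous_const)

lemma continuousOn_Sig_inv_mulVec (hC : Continuous C) {t : ℝ} {I : Set ℝ}
    (hI : ∀ s ∈ I, 0 < (Sig C t s).det) (y : Fin D → ℝ) (d : Fin D) :
    ContinuousOn (fun p : ℝ × (Fin D → ℝ) => ((Sig C t p.1)⁻¹ *ᵥ (p.2 - y)) d)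
      (I ×ˢ Set.univ) := by
  simp only [Matrix.mulVec, dotProduct]
  exact continuousOn_finsetSum _ fun j _ =>
    (continuousOn_Sig_inv_apply hC hI d j).mul (continuous_snd_sub_apply y j).continuousOn

lemma continuousOn_gk_Sig (hC : Continuous C) {t : ℝ} {I : Set ℝ}
    (hI : ∀ s ∈ I, 0 < (Sig C t s).det) (y : Fin D → ℝ) :
    ContinuousOn (fun p : ℝ × (Fin D → ℝ) => gk (Sig C t p.1) (p.2 - y)) (I ×ˢ Set.univ) := by
  have h2 : Continuous fun p : ℝ × (Fin D → ℝ) => √(Sig C t p.1).det :=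
    ((continuous_Sig hC t).matrix_det.comp continuous_fst).sqrt
  have h3 : ContinuousOn (fun p : ℝ × (Fin D → ℝ) => (p.2 - y) ⬝ᵥ (Sig C t p.1)⁻¹ *ᵥ (p.2 - y))
      (I ×ˢ Set.univ) :=
    continuousOn_finsetSum _ fun i _ => (continuous_snd_sub_apply y i).continuousOn.mul
      (continuousOn_Sig_inv_mulVec hC hI y i)
  unfold gk
  refine ContinuousOn.div (Real.continuous_exp.comp_continuousOn (continuousOn_const.mul h3))
    (continuousOn_const.mul h2.continuousOn) fun p hp => ?_
  have := Real.sqrt_pos.2 (hI p.1 hp.1)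
  positivity

end Sig

lemma aestronglyMeasurable_integral_of_continuousOn {D : ℕ} {I : Set ℝ} (hI : MeasurableSet I)
    {F : ℝ → (Fin D → ℝ) → ℝ}
    (hF : ContinuousOn (fun p : ℝ × (Fin D → ℝ) => F p.1 p.2) (I ×ˢ Set.univ)) :
    AEStronglyMeasurable (fun s => ∫ x, F s x) (volume.restrict I) := by
  have h1 := hF.aestronglyMeasurable (μ := (volume : Measure ℝ).prod (volume : Measure (Fin D → ℝ)))
    (hI.prod MeasurableSet.univ)
  rw [← Measure.prod_restrict, Measure.restrict_univ] at h1
  exact h1.integral_prod_right'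

lemma inv_mul_sqrt_rpow {δ δ' τ β : ℝ} (hδ' : 0 ≤ δ') (hτ : 0 < τ) :
    (δ * τ)⁻¹ * √(δ' * τ) ^ (1 + β) = δ⁻¹ * √δ' ^ (1 + β) * τ ^ ((β - 1) / 2) := by
  rw [Real.sqrt_mul hδ', Real.mul_rpow (Real.sqrt_nonneg _) (Real.sqrt_nonneg _),
    Real.sqrt_eq_rpow τ, ← Real.rpow_mul hτ.le, mul_inv]
  have : τ ^ (1 / 2 * (1 + β)) = τ * τ ^ ((β - 1) / 2) := by
    rw [show 1 / 2 * (1 + β) = 1 + (β - 1) / 2 by ring, Real.rpow_add hτ, Real.rpow_one]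
  rw [this]
  field_simp

lemma intervalIntegrable_sub_rpow {t T p : ℝ} (hp : -1 < p) :
    IntervalIntegrable (fun s => (s - t) ^ p) volume t T := by
  have := (intervalIntegral.intervalIntegrable_rpow' (a := 0) (b := T - t) hp).comp_sub_right t
  simpa using this

lemma integral_sub_rpow {t T p : ℝ} (hp : -1 < p) :
    ∫ s in t..T, (s - t) ^ p = (T - t) ^ (p + 1) / (p + 1) := by
  rw [intervalIntegral.integral_comp_sub_right (fun s => s ^ p) t, integral_rpow (Or.inl hp),
    sub_self, Real.zero_rpow (by linarith), sub_zero]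

/-- Differentiability of the Duhamel term, together with the Hölder bound on its derivative. -/
lemma exists_hasDerivAt_duhamel {D : ℕ} {C : ℝ → Matrix (Fin D) (Fin D) ℝ} {δ δ' α : ℝ}
    (hδ : 0 < δ) (hδδ : δ ≤ δ') (hα : 0 < α) (hC : Continuous C) (hE : Ellip D δ δ' C)
    {t T : ℝ} (ht : 0 ≤ t) (htT : t < T) (hT : T ≤ 1) {f : ℝ → (Fin D → ℝ) → ℝ} {M F : ℝ}
    (hM : ∀ s ∈ Set.Icc (0:ℝ) T, ∀ x, |f s x| ≤ M)
    (hf : ContinuousOn (fun p : ℝ × (Fin D → ℝ) => f p.1 p.2) (Set.Icc 0 T ×ˢ Set.univ))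
    (hF0 : 0 ≤ F) (hF : ∀ s ∈ Set.Icc (0:ℝ) T, ∀ x y, |f s x - f s y| ≤ F * en (x - y) ^ α)
    (d : Fin D) (y : Fin D → ℝ) :
    ∃ v, HasDerivAt (fun r : ℝ => ∫ s in t..T, ∫ x, Gam C t s (x - (y + r • Pi.single d 1)) * f s x)
        v 0 ∧
      |v| ≤ F * (δ⁻¹ * √δ' ^ (1 + α) * mom D (1 + α) * (2 / (1 + α))) * (T - t) ^ ((1 + α) / 2) := by
  have hsub : Set.Ioc t T ⊆ Set.Icc 0 T := fun s hs => ⟨ht.trans hs.1.le, hs.2⟩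
  have hell : ∀ s ∈ Set.Ioc t T, EllM (Sig C t s) (δ * (s - t)) (δ' * (s - t)) := fun s hs =>
    ellM_Sig hδ hδδ hC hE ht hs.1 (hs.2.trans hT)
  have hdet : ∀ s ∈ Set.Ioc t T, 0 < (Sig C t s).det := fun s hs => (hell s hs).det_pos
  have hfc : ContinuousOn (fun p : ℝ × (Fin D → ℝ) => f p.1 p.2) (Set.Ioc t T ×ˢ Set.univ) :=
    hf.mono (Set.prod_mono hsub le_rfl)
  have hfs : ∀ s ∈ Set.Ioc t T, AEStronglyMeasurable (f s) := fun s hs => by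
    have : Continuous (f s) := by
      rw [← continuousOn_univ]
      exact hf.comp (f := fun x => (s, x)) (by fun_prop) fun x _ => ⟨hsub hs, Set.mem_univ _⟩
    exact this.aestronglyMeasurable
  simp_rw [Gam_eq_gk]
  set e : Fin D → ℝ := Pi.single d 1 with he
  have hu : Set.uIoc t T = Set.Ioc t T := Set.uIoc_of_le htT.le
  have hmeas : ∀ r : ℝ, AEStronglyMeasurable
      (fun s => ∫ x, gk (Sig C t s) (x - (y + r • e)) * f s x)
      (volume.restrict (Set.uIoc t T)) := fun r => by
    rw [hu]
    exact aestronglyMeasurable_integral_of_continuousOn measurableSet_Ioc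
      ((continuousOn_gk_Sig hC hdet _).mul hfc)
  have hmeas' : AEStronglyMeasurable
      (fun s => ∫ x, gk (Sig C t s) (x - (y + (0:ℝ) • e)) *
        ((Sig C t s)⁻¹ *ᵥ (x - (y + (0:ℝ) • e))) d * f s x)
      (volume.restrict (Set.uIoc t T)) := by
    rw [hu]
    exact aestronglyMeasurable_integral_of_continuousOn measurableSet_Ioc
      (((continuousOn_gk_Sig hC hdet _).mul (continuousOn_Sig_inv_mulVec hC hdet _ d)).mul hfc)
  have hint : IntervalIntegrable (fun s => ∫ x, gk (Sig C t s) (x - (y + (0:ℝ) • e)) * f s x)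
      volume t T := by
    rw [intervalIntegrable_iff]
    refine Integrable.mono' (g := fun _ => M) (by simp [hu]) (hmeas 0) ?_
    refine (ae_restrict_iff' measurableSet_uIoc).2 (Filter.Eventually.of_forall fun s hs => ?_)
    rw [hu] at hs
    have h1 := (hell s hs).integrable_gk.comp_sub_right (y + (0:ℝ) • e)
    refine (norm_integral_le_of_norm_le (h1.mul_const M)
      (Filter.Eventually.of_forall fun x => ?_)).trans ?_
    · rw [norm_mul, Real.norm_of_nonneg (gk_nonneg _ _)]
      exact mul_le_mul_of_nonneg_left (hM s (hsub hs) x) (gk_nonneg _ _)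
    · rw [integral_mul_const, integral_sub_right_eq_self, (hell s hs).integral_gk, one_mul]
  have hbound : ∀ s ∈ Set.uIoc t T, ∀ r ∈ Metric.ball (0:ℝ) 1,
      ‖∫ x, gk (Sig C t s) (x - (y + r • e)) *
        ((Sig C t s)⁻¹ *ᵥ (x - (y + r • e))) d * f s x‖ ≤
      M * mom D 1 * (δ⁻¹ * √δ' ^ (1 + (0:ℝ))) * (s - t) ^ (((0:ℝ) - 1) / 2) := fun s hs r _ => by
    rw [hu] at hs
    refine ((hell s hs).abs_integral_deriv_gk_le (hM s (hsub hs)) _ d).trans_eq ?_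
    rw [mul_assoc _ (_ * _) (_ ^ _), ← inv_mul_sqrt_rpow (hδ.le.trans hδδ) (sub_pos.2 hs.1)]
    rw [add_zero, Real.rpow_one]
    ring
  have hderiv : ∀ s ∈ Set.uIoc t T, ∀ r ∈ Metric.ball (0:ℝ) 1, HasDerivAt
      (fun r : ℝ => ∫ x, gk (Sig C t s) (x - (y + r • e)) * f s x)
      (∫ x, gk (Sig C t s) (x - (y + r • e)) *
        ((Sig C t s)⁻¹ *ᵥ (x - (y + r • e))) d * f s x) r := fun s hs r _ => by
    rw [hu] at hs
    exact (hell s hs).hasDerivAt_integral_gk (hfs s hs) (hM s (hsub hs)) y d r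
  have key := intervalIntegral.hasDerivAt_integral_of_dominated_loc_of_deriv_le (𝕜 := ℝ)
    (μ := volume) (Metric.ball_mem_nhds 0 one_pos) (Filter.Eventually.of_forall hmeas) hint hmeas'
    (Filter.Eventually.of_forall hbound)
    ((intervalIntegrable_sub_rpow (by norm_num)).const_mul _) (Filter.Eventually.of_forall hderiv)
  refine ⟨_, key.2, ?_⟩
  have hp : -1 < (α - 1) / 2 := by linarith
  rw [← Real.norm_eq_abs]
  refine (intervalIntegral.norm_integral_le_of_norm_le htT.le
    (g := fun s => F * mom D (1 + α) * (δ⁻¹ * √δ' ^ (1 + α)) * (s - t) ^ ((α - 1) / 2))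
    (Filter.Eventually.of_forall fun s hs => ?_)
    ((intervalIntegrable_sub_rpow hp).const_mul _)).trans_eq ?_
  · refine ((hell s hs).abs_integral_deriv_gk_le_of_holder (hfs s hs) (hM s (hsub hs)) hα.le hF0 _
      (fun x => hF s (hsub hs) x _) d).trans_eq ?_
    rw [mul_assoc _ (_ * _) (_ ^ _), ← inv_mul_sqrt_rpow (hδ.le.trans hδδ) (sub_pos.2 hs.1)]
    ring
  · rw [intervalIntegral.integral_const_mul, integral_sub_rpow hp]
    have h1 : (α - 1) / 2 + 1 = (1 + α) / 2 := by ring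
    rw [h1]
    field_simp

lemma abs_sub_le_sSup_hsemiSet {D : ℕ} {α : ℝ} {φ : (Fin D → ℝ) → ℝ}
    (h : BddAbove (hsemiSet α φ)) (x y : Fin D → ℝ) :
    |φ x - φ y| ≤ sSup (hsemiSet α φ) * en (x - y) ^ α := by
  rcases eq_or_ne x y with rfl | hxy
  · have : 0 ≤ sSup (hsemiSet α φ) := Real.sSup_nonneg (by
      rintro _ ⟨x, y, -, rfl⟩
      exact div_nonneg (abs_nonneg _) (Real.rpow_nonneg (en_nonneg _) _))
    rw [sub_self, abs_zero]
    exact mul_nonneg this (Real.rpow_nonneg (en_nonneg _) _)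
  · have hpos : 0 < en (x - y) := (en_nonneg _).lt_of_ne fun h0 =>
      hxy (sub_eq_zero.1 (en_eq_zero h0.symm))
    rw [← div_le_iff₀ (Real.rpow_pos_of_pos hpos _)]
    exact le_csSup h ⟨x, y, hxy, rfl⟩

lemma sSup_hsemiSet_nonneg {D : ℕ} {α : ℝ} {φ : (Fin D → ℝ) → ℝ} : 0 ≤ sSup (hsemiSet α φ) :=
  Real.sSup_nonneg (by
    rintro _ ⟨x, y, -, rfl⟩
    exact div_nonneg (abs_nonneg _) (Real.rpow_nonneg (en_nonneg _) _))

lemma sSup_psemiSet_nonneg {D : ℕ} {T α : ℝ} {f : ℝ → (Fin D → ℝ) → ℝ} :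
    0 ≤ sSup (psemiSet T α f) :=
  Real.sSup_nonneg (by
    rintro _ ⟨t, x, s, y, -, -, -, rfl⟩
    exact div_nonneg (abs_nonneg _)
      (Real.rpow_nonneg (add_nonneg (Real.sqrt_nonneg _) (en_nonneg _)) _))

lemma abs_sub_le_sSup_psemiSet {D : ℕ} {T α : ℝ} {f : ℝ → (Fin D → ℝ) → ℝ}
    (h : BddAbove (psemiSet T α f)) {s : ℝ} (hs : s ∈ Set.Icc 0 T) (x y : Fin D → ℝ) :
    |f s x - f s y| ≤ sSup (psemiSet T α f) * en (x - y) ^ α := by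
  rcases eq_or_ne x y with rfl | hxy
  · rw [sub_self, abs_zero]
    exact mul_nonneg sSup_psemiSet_nonneg (Real.rpow_nonneg (en_nonneg _) _)
  · have hpos : 0 < en (x - y) := (en_nonneg _).lt_of_ne fun h0 =>
      hxy (sub_eq_zero.1 (en_eq_zero h0.symm))
    rw [← div_le_iff₀ (Real.rpow_pos_of_pos hpos _)]
    exact le_csSup h ⟨s, x, s, y, hs, hs, by simpa using hxy, by simp⟩

theorem stmt13 (D : ℕ) (δ δ' α : ℝ) (hδ : 0 < δ) (hδδ : δ ≤ δ')
    (hα : α ∈ Set.Ioo (0:ℝ) 1) :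
    ∃ c > 0, ∀ C : ℝ → Matrix (Fin D) (Fin D) ℝ, Continuous C → Ellip D δ δ' C →
      ∀ T ∈ Set.Ioc (0:ℝ) 1,
      ∀ g : (Fin D → ℝ) → ℝ, ContDiff ℝ 2 g →
        (∃ M, ∀ x, (∀ d, |pd g d x| ≤ M) ∧ ∀ d e, |pdd g d e x| ≤ M) →
        (∀ d e : Fin D, BddAbove (hsemiSet α (pdd g d e))) →
      ∀ f : ℝ → (Fin D → ℝ) → ℝ,
        (∃ M, ∀ s ∈ Set.Icc (0:ℝ) T, ∀ x, |f s x| ≤ M) →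
        ContinuousOn (fun p : ℝ × (Fin D → ℝ) => f p.1 p.2) (Set.Icc 0 T ×ˢ Set.univ) →
        BddAbove (psemiSet T α f) →
      ∀ d : Fin D, ∀ t ∈ Set.Ico (0:ℝ) T, ∀ y : Fin D → ℝ,
        ∃ du : ℝ,
          HasLineDerivAt ℝ
            (fun y' => (∫ x : Fin D → ℝ, Gam C t T (x - y') * g x) +
              ∫ s in t..T, ∫ x : Fin D → ℝ, Gam C t s (x - y') * f s x)
            du y (Pi.single d 1) ∧
          |du - pd g d y| ≤
            c * ((∑ d' : Fin D, ∑ e : Fin D, sSup (hsemiSet α (pdd g d' e))) +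
                sSup (psemiSet T α f)) * (T - t) ^ ((1 + α) / 2) := by
  have hδ' : 0 ≤ δ' := hδ.le.trans hδδ
  have hα0 := hα.1
  set κ := √δ' ^ (1 + α) * mom D (1 + α) with hκ
  have hκ0 : 0 ≤ κ := mul_nonneg (Real.rpow_nonneg (Real.sqrt_nonneg _) _) (mom_nonneg _ _)
  have hL0 : 0 ≤ δ⁻¹ * (2 / (1 + α)) := by positivity
  refine ⟨κ * (1 + δ⁻¹ * (2 / (1 + α))) + 1, by positivity, ?_⟩
  rintro C hC hE T ⟨-, hT⟩ g hg ⟨Mg, hMg⟩ hgH f ⟨Mf, hMf⟩ hfc hfH d t ⟨ht, htT⟩ y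
  have hτ : 0 < T - t := sub_pos.2 htT
  obtain ⟨v, hv, hvle⟩ := exists_hasDerivAt_duhamel hδ hδδ hα0 hC hE ht htT hT hMf hfc
    sSup_psemiSet_nonneg (fun s hs => abs_sub_le_sSup_psemiSet hfH hs) d y
  have hell := ellM_Sig hδ hδδ hC hE ht htT hT
  have hgd := hell.hasDerivAt_integral_gk_of_contDiff (hg.of_le one_le_two)
    (fun x => (hMg x).1) y d
  have hgle := hell.abs_integral_gk_sub_le (contDiff_pd hg d) (fun x => (hMg x).1 d) hα0.le
    (H := fun e => sSup (hsemiSet α (pdd g e d)))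
    (fun e => abs_sub_le_sSup_hsemiSet (hgH e d)) (fun e => sSup_hsemiSet_nonneg) y
  refine ⟨(∫ x, gk (Sig C t T) x * pd g d (y + x)) + v, ?_, ?_⟩
  · unfold HasLineDerivAt
    refine HasDerivAt.add ?_ hv
    simpa only [Gam_eq_gk] using hgd
  set F := sSup (psemiSet T α f)
  set G := ∑ d' : Fin D, ∑ e : Fin D, sSup (hsemiSet α (pdd g d' e))
  have hF0 : 0 ≤ F := sSup_psemiSet_nonneg
  have hG : ∑ e, sSup (hsemiSet α (pdd g e d)) ≤ G := Finset.sum_le_sum fun e _ =>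
    Finset.single_le_sum (f := fun d => sSup (hsemiSet α (pdd g e d)))
      (fun _ _ => sSup_hsemiSet_nonneg) (Finset.mem_univ d)
  have hG0 : 0 ≤ G := Finset.sum_nonneg fun _ _ => Finset.sum_nonneg fun _ _ =>
    sSup_hsemiSet_nonneg
  set P := (T - t) ^ ((1 + α) / 2) with hP
  have hP0 : 0 ≤ P := Real.rpow_nonneg hτ.le _
  have hsq : √(δ' * (T - t)) ^ (1 + α) * mom D (1 + α) = κ * P := by
    rw [Real.sqrt_mul hδ', Real.mul_rpow (Real.sqrt_nonneg _) (Real.sqrt_nonneg _),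
      Real.sqrt_eq_rpow (T - t), ← Real.rpow_mul hτ.le, hκ, hP, one_div_mul_eq_div]
    ring
  rw [hsq] at hgle
  have h1 : |(∫ x, gk (Sig C t T) x * pd g d (y + x)) - pd g d y| ≤ G * (κ * P) :=
    hgle.trans (mul_le_mul_of_nonneg_right hG (mul_nonneg hκ0 hP0))
  have h2 : |v| ≤ F * (κ * (δ⁻¹ * (2 / (1 + α)))) * P := hvle.trans_eq (by rw [hκ]; ring)
  rw [add_sub_right_comm]
  refine (abs_add_le _ _).trans ((add_le_add h1 h2).trans ?_)
  have e1 : 0 ≤ G * P := mul_nonneg hG0 hP0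
  have e2 : 0 ≤ F * P := mul_nonneg hF0 hP0
  have e3 : 0 ≤ G * P * (κ * (δ⁻¹ * (2 / (1 + α)))) := mul_nonneg e1 (mul_nonneg hκ0 hL0)
  have e4 : 0 ≤ F * P * κ := mul_nonneg e2 hκ0
  linarith
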